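/- Let α' = (α'_1,…,α'_n) ∈ ℕ^n, let R' be a lattice in O^n belonging to S_{α'}, let 1 ≤ l ≤ n, and define β ∈ ℕ^n by β_l = α'_l + 1 and β_j = α'_j for j ≠ l. Then the set of lattices R ⊆ R' with dim_K(R'/R) = 1 and R belonging to S_β is in bijection with the affine space K^{n−l}. -/

import Mathlib

open PowerSeries

noncomputable section

variable (K : Type*) [Field K]

/-- The submodule `O·e 0 ⊕ ⋯ ⊕ O·e i` of `O^n`: vectors supported on coordinates `≤ i`. -/
def coordsLE {n : ℕ} (i : Fin n) :
    Submodule (PowerSeries K) (Fin n → PowerSeries K) where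
  carrier := {v | ∀ j, i < j → v j = 0}
  zero_mem' := fun j _ => rfl
  add_mem' := fun {a b} ha hb j hj => by simp [ha j hj, hb j hj]
  smul_mem' := fun c v hv j hj => by simp [hv j hj]

/-- The lattice `R` belongs to the stratum `S_α`. -/
def MemS {n : ℕ} (α : Fin n → ℕ)
    (R : Submodule (PowerSeries K) (Fin n → PowerSeries K)) : Prop :=
  ∀ i : Fin n,
    Submodule.map (LinearMap.proj i) (R ⊓ coordsLE K i)
      = Submodule.span (PowerSeries K) {X ^ α i}

/-- `R ⊆ O^n` has finite codimension as a `K`-vector space. -/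
def IsLattice {n : ℕ} (R : Submodule (PowerSeries K) (Fin n → PowerSeries K)) : Prop :=
  FiniteDimensional K ((Fin n → PowerSeries K) ⧸ R.restrictScalars K)

/-- The lattice `R` belongs to the orbit `X_μ`, i.e. `R = g·ϖ^μ·O^n` for some `g ∈ GL_n(O)`. -/
def MemX {n : ℕ} (μ : Fin n → ℕ)
    (R : Submodule (PowerSeries K) (Fin n → PowerSeries K)) : Prop :=
  ∃ g : GL (Fin n) (PowerSeries K),
    LinearMap.range (Matrix.mulVecLin
      ((g : Matrix (Fin n) (Fin n) (PowerSeries K)) *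
        Matrix.diagonal fun i => X ^ μ i)) = R

/-- `u` is upper triangular unipotent. -/
def UnipUpper {A : Type*} [CommRing A] {n : ℕ} (u : Matrix (Fin n) (Fin n) A) : Prop :=
  (∀ i, u i i = 1) ∧ ∀ i j : Fin n, j < i → u i j = 0

/-- The image of `ϖ` in `F = K((ϖ))`. -/
def varpi : LaurentSeries K := algebraMap (PowerSeries K) (LaurentSeries K) X

/-- The `O`-lattice `g·O^n ⊆ F^n` generated by the columns of a matrix `g` over `F`. -/
def latticeOf {n : ℕ} (g : Matrix (Fin n) (Fin n) (LaurentSeries K)) :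
    Submodule (PowerSeries K) (Fin n → LaurentSeries K) :=
  Submodule.span (PowerSeries K) (Set.range fun j i => g i j)

/-- `Σ_{i=1}^{n-1} res(u_{i,i+1} dϖ)`. -/
def resSum {n : ℕ} (u : Matrix (Fin n) (Fin n) (LaurentSeries K)) : K :=
  ∑ i : Fin n, if h : (i : ℕ) + 1 < n then (u i ⟨(i : ℕ) + 1, h⟩).coeff (-1) else 0

/-- A lattice `R ⊆ F^n` belongs to `X_μ`. -/
def MemXF {n : ℕ} (μ : Fin n → ℕ)
    (R : Submodule (PowerSeries K) (Fin n → LaurentSeries K)) : Prop :=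
  ∃ g : GL (Fin n) (PowerSeries K),
    R = latticeOf K
      (((g : Matrix (Fin n) (Fin n) (PowerSeries K)).map
          (algebraMap (PowerSeries K) (LaurentSeries K))) *
        Matrix.diagonal fun i => varpi K ^ μ i)

/-- The canonical inclusion `O^n →ₗ[O] F^n`. -/
def toLaurent (n : ℕ) : (Fin n → PowerSeries K) →ₗ[PowerSeries K] (Fin n → LaurentSeries K) :=
  LinearMap.pi fun i =>
    (Algebra.linearMap (PowerSeries K) (LaurentSeries K)).comp (LinearMap.proj i)

section ResidueForm

variable {K} {ι M : Type*} [Fintype ι] [AddCommGroup M] [Module (PowerSeries K) M] [Module K M]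
  [IsScalarTower K (PowerSeries K) M]

/-- The `K`-linear form on a free `K⟦X⟧`-module which reduces coordinates modulo `X` and pairs them
with `c`. -/
def residueForm (B : Module.Basis ι (PowerSeries K) M) (c : ι → K) : M →ₗ[K] K where
  toFun v := ∑ j, c j * constantCoeff (B.repr v j)
  map_add' v w := by simp [mul_add, Finset.sum_add_distrib]
  map_smul' a v := by
    rw [← algebraMap_smul (PowerSeries K) a v]
    simp [Finset.mul_sum, mul_left_comm]

theorem residueForm_apply (B : Module.Basis ι (PowerSeries K) M) (c : ι → K) (v : M) :
    residueForm B c v = ∑ j, c j * constantCoeff (B.repr v j) := rfl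

theorem residueForm_smul (B : Module.Basis ι (PowerSeries K) M) (c : ι → K)
    (f : PowerSeries K) (v : M) :
    residueForm B c (f • v) = constantCoeff f * residueForm B c v := by
  simp [residueForm_apply, Finset.mul_sum, mul_left_comm]

theorem residueForm_basis [DecidableEq ι] (B : Module.Basis ι (PowerSeries K) M) (c : ι → K)
    (i : ι) : residueForm B c (B i) = c i := by
  simp [residueForm_apply, Finsupp.single_apply, apply_ite]

/-- The kernel of `residueForm B c`, as a `K⟦X⟧`-submodule. -/
def residueKer (B : Module.Basis ι (PowerSeries K) M) (c : ι → K) :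
    Submodule (PowerSeries K) M where
  carrier := {v | residueForm B c v = 0}
  zero_mem' := map_zero _
  add_mem' {a b} ha hb := by
    simp only [Set.mem_ofPred_eq] at ha hb ⊢
    rw [map_add, ha, hb, add_zero]
  smul_mem' f v hv := by
    simp only [Set.mem_ofPred_eq] at hv ⊢
    rw [residueForm_smul, hv, mul_zero]

theorem mem_residueKer {B : Module.Basis ι (PowerSeries K) M} {c : ι → K} {v : M} :
    v ∈ residueKer B c ↔ residueForm B c v = 0 := Iff.rfl

theorem residueKer_smul (B : Module.Basis ι (PowerSeries K) M) (c : ι → K) {a : K} (ha : a ≠ 0) :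
    residueKer B (a • c) = residueKer B c := by
  ext v
  simp [mem_residueKer, residueForm_apply, mul_assoc, ← Finset.mul_sum, ha]

theorem finrank_quotient_residueKer (B : Module.Basis ι (PowerSeries K) M) (c : ι → K) {i : ι}
    (hc : c i ≠ 0) :
    Module.finrank K (M ⧸ (residueKer B c).restrictScalars K) = 1 := by
  classical
  have hsurj : Function.Surjective (residueForm B c) := fun a =>
    ⟨(a / c i) • B i, by rw [map_smul, residueForm_basis, smul_eq_mul, div_mul_cancel₀ _ hc]⟩
  have hker : (residueKer B c).restrictScalars K = LinearMap.ker (residueForm B c) := by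
    ext v
    simp [mem_residueKer]
  rw [hker, ((residueForm B c).quotKerEquivOfSurjective hsurj).finrank_eq, Module.finrank_self]

/-- On a one-dimensional quotient, a power series acts through its constant coefficient. -/
theorem map_smul_eq_constantCoeff_mul {N : Submodule (PowerSeries K) M} {φ : M →ₗ[K] K}
    (hφ : Function.Surjective φ) (hN : ∀ v, v ∈ N ↔ φ v = 0) (f : PowerSeries K) (v : M) :
    φ (f • v) = constantCoeff f * φ v := by
  obtain ⟨u, hu⟩ := hφ 1
  have key : ∀ g : PowerSeries K, ∀ w, φ (g • w) = φ (g • u) * φ w := by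
    intro g w
    have hw : w - (φ w) • u ∈ N := by
      rw [hN, map_sub, map_smul, hu, smul_eq_mul, mul_one, sub_self]
    have h := (hN _).1 (N.smul_mem g hw)
    rw [smul_sub, smul_comm, map_sub, φ.map_smul, smul_eq_mul] at h
    rw [sub_eq_zero.1 h, mul_comm]
  have hconst : φ (f • u) = constantCoeff f := by
    by_contra hne
    set a := φ (f • u)
    have hunit : IsUnit (f - C a) := by
      rw [isUnit_iff_constantCoeff, isUnit_iff_ne_zero]
      simpa [sub_eq_zero] using Ne.symm hne
    obtain ⟨g, hg⟩ := hunit.exists_right_inv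
    have h0 : φ ((f - C a) • u) = 0 := by
      have : (C a : PowerSeries K) • u = a • u := algebraMap_smul (PowerSeries K) a u
      rw [sub_smul, map_sub, this, φ.map_smul, hu, smul_eq_mul, mul_one, sub_self]
    have h1 := key (f - C a) (g • u)
    rw [smul_smul, hg, one_smul, hu, h0, zero_mul] at h1
    exact one_ne_zero h1
  rw [key, hconst]

theorem exists_eq_residueKer (B : Module.Basis ι (PowerSeries K) M)
    (N : Submodule (PowerSeries K) M)
    (hN : Module.finrank K (M ⧸ N.restrictScalars K) = 1) :
    ∃ c : ι → K, N = residueKer B c := by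
  have : FiniteDimensional K (M ⧸ N.restrictScalars K) :=
    Module.finite_of_finrank_pos (by omega)
  let e : (M ⧸ N.restrictScalars K) ≃ₗ[K] K :=
    LinearEquiv.ofFinrankEq _ _ (by rw [hN, Module.finrank_self])
  let φ : M →ₗ[K] K := e.toLinearMap ∘ₗ (N.restrictScalars K).mkQ
  have hφ : Function.Surjective φ := e.surjective.comp (Submodule.mkQ_surjective _)
  have hker : ∀ v, v ∈ N ↔ φ v = 0 := by
    intro v
    simp [φ]
  refine ⟨fun i => φ (B i), ?_⟩
  ext v
  rw [hker, mem_residueKer, residueForm_apply]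
  conv_lhs => rw [← B.sum_repr v, map_sum]
  simp only [map_smul_eq_constantCoeff_mul hφ hker, mul_comm]

end ResidueForm

section TriangularBasis

variable {K} {n : ℕ} {α : Fin n → ℕ}
  {R : Submodule (PowerSeries K) (Fin n → PowerSeries K)}

/-- The pivots of `R` are realised by vectors of `R`. -/
theorem MemS.exists_pivot (h : MemS K α R) (i : Fin n) :
    ∃ v ∈ R, v ∈ coordsLE K i ∧ v i = X ^ α i := by
  have hmem : (X ^ α i : PowerSeries K) ∈
      Submodule.map (LinearMap.proj (R := PowerSeries K) (φ := fun _ => PowerSeries K) i)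
        (R ⊓ coordsLE K i) := by
    rw [h i]
    exact Submodule.mem_span_singleton_self _
  obtain ⟨v, ⟨hv, hv'⟩, hvi⟩ := hmem
  exact ⟨v, hv, hv', hvi⟩

theorem MemS.pow_dvd (h : MemS K α R) {i : Fin n} {v : Fin n → PowerSeries K} (hv : v ∈ R)
    (hvi : v ∈ coordsLE K i) : X ^ α i ∣ v i := by
  have hmem : v i ∈
      Submodule.map (LinearMap.proj (R := PowerSeries K) (φ := fun _ => PowerSeries K) i)
        (R ⊓ coordsLE K i) := ⟨v, ⟨hv, hvi⟩, rfl⟩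
  rwa [h i, ← Ideal.span, Ideal.mem_span_singleton] at hmem

theorem memS_of_pivots (hpiv : ∀ i, ∃ v ∈ R, v ∈ coordsLE K i ∧ v i = X ^ α i)
    (hdvd : ∀ i, ∀ v ∈ R, v ∈ coordsLE K i → X ^ α i ∣ v i) : MemS K α R := by
  intro i
  apply le_antisymm
  · rintro _ ⟨v, ⟨hv, hvi⟩, rfl⟩
    rw [← Ideal.span, Ideal.mem_span_singleton]
    exact hdvd i v hv hvi
  · rw [Submodule.span_le, Set.singleton_subset_iff]
    obtain ⟨v, hv, hv', hvi⟩ := hpiv i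
    exact ⟨v, ⟨hv, hv'⟩, hvi⟩

/-- A vector of `R` supported in coordinates `< m` is a combination of the pivot vectors with
index `< m`. -/
theorem MemS.exists_sum_eq (h : MemS K α R) {b : Fin n → Fin n → PowerSeries K}
    (hbR : ∀ i, b i ∈ R) (hb : ∀ i, b i ∈ coordsLE K i) (hbi : ∀ i, b i i = X ^ α i) (m : ℕ) :
    ∀ v ∈ R, (∀ j : Fin n, m ≤ j → v j = 0) →
      ∃ c : Fin n → PowerSeries K, (∀ j : Fin n, m ≤ j → c j = 0) ∧ v = ∑ j, c j • b j := by
  induction m with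
  | zero =>
    intro v _ hv
    exact ⟨0, fun _ _ => rfl, by ext1 j; simp [hv j (Nat.zero_le _)]⟩
  | succ m ih =>
    intro v hvR hv
    by_cases hm : m < n
    · let i : Fin n := ⟨m, hm⟩
      have hvi : v ∈ coordsLE K i := fun j hj => hv j (Fin.lt_def.1 hj)
      obtain ⟨f, hf⟩ := h.pow_dvd hvR hvi
      obtain ⟨c, hc, hsum⟩ := ih (v - f • b i) (R.sub_mem hvR (R.smul_mem f (hbR i))) (by
        intro j hj
        rcases hj.eq_or_lt with hj | hj
        · obtain rfl : i = j := Fin.ext hj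
          simp [hf, hbi, mul_comm]
        · have hij : i < j := Fin.lt_def.2 hj
          simp [hvi j hij, hb i j hij])
      refine ⟨c + Pi.single i f, fun j hj => ?_, ?_⟩
      · have hji : j ≠ i := by
          rintro rfl
          simp [i] at hj
        simp [hc j (by omega), hji]
      · simp only [Pi.add_apply, add_smul, Finset.sum_add_distrib, ← hsum]
        rw [Finset.sum_eq_single i (fun j _ hj => by simp [hj]) (by simp)]
        simp
    · obtain ⟨c, hc, hsum⟩ := ih v hvR (fun j hj => by omega)
      exact ⟨c, fun j hj => by omega, hsum⟩

/-- A basis of `R` consisting of pivot vectors, with respect to which the vectors supported in the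
first coordinates have triangular coordinates. -/
theorem MemS.exists_basis (h : MemS K α R) :
    ∃ B : Module.Basis (Fin n) (PowerSeries K) R,
      (∀ i, (B i : Fin n → PowerSeries K) ∈ coordsLE K i) ∧
      (∀ i, (B i : Fin n → PowerSeries K) i = X ^ α i) ∧
      ∀ (i : Fin n) (v : R), (v : Fin n → PowerSeries K) ∈ coordsLE K i →
        (∀ j, i < j → B.repr v j = 0) ∧
          (v : Fin n → PowerSeries K) i = B.repr v i * X ^ α i := by
  choose b hbR hb hbi using h.exists_pivot
  have hli : LinearIndependent (PowerSeries K) fun i => (⟨b i, hbR i⟩ : R) := by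
    apply LinearIndependent.of_comp R.subtype
    have hdet : (Matrix.of b).det ≠ 0 := by
      rw [Matrix.det_of_isLowerTriangular (Matrix.of b) fun i j hij => hb i j hij]
      simp [hbi, Finset.prod_ne_zero_iff, X_ne_zero]
    exact Matrix.linearIndependent_rows_of_det_ne_zero hdet
  have hspan : ⊤ ≤ Submodule.span (PowerSeries K) (Set.range fun i => (⟨b i, hbR i⟩ : R)) := by
    rintro ⟨v, hv⟩ -
    obtain ⟨c, -, hc⟩ := h.exists_sum_eq hbR hb hbi n v hv (fun j hj => by omega)
    rw [Submodule.mem_span_range_iff_exists_fun]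
    exact ⟨c, Subtype.ext (by simp [hc])⟩
  refine ⟨Module.Basis.mk hli hspan, fun i => by simpa using hb i,
    fun i => by simpa using hbi i, fun i v hv => ?_⟩
  obtain ⟨c, hc, hsum⟩ := h.exists_sum_eq hbR hb hbi (i + 1) v v.2
    (fun j hj => hv j (Fin.lt_def.2 hj))
  set B := Module.Basis.mk hli hspan with hB
  have hrepr : ∀ j, B.repr v j = c j := by
    have : v = ∑ j, c j • B j := Subtype.ext (by simp [hB, ← hsum])
    intro j
    rw [this, B.repr_sum_self]
  refine ⟨fun j hj => by rw [hrepr, hc j hj], ?_⟩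
  rw [hrepr, hsum, Finset.sum_apply, Finset.sum_eq_single i _ (by simp)]
  · simp [hbi]
  · intro j _ hji
    rcases lt_or_gt_of_ne hji with hj | hj
    · simp [hb j i hj]
    · simp [hc j hj]

variable {B : Module.Basis (Fin n) (PowerSeries K) R}

/-- The hyperplane of `R` cut out by `c` has its pivots raised exactly at the first non-zero
entry of `c`. -/
theorem MemS.memS_residueKer (h : MemS K α R)
    (hB : ∀ i, (B i : Fin n → PowerSeries K) ∈ coordsLE K i)
    (hBi : ∀ i, (B i : Fin n → PowerSeries K) i = X ^ α i)
    (hrepr : ∀ (i : Fin n) (v : R), (v : Fin n → PowerSeries K) ∈ coordsLE K i →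
        (∀ j, i < j → B.repr v j = 0) ∧
          (v : Fin n → PowerSeries K) i = B.repr v i * X ^ α i)
    {l : Fin n} {c : Fin n → K} (hc : ∀ i < l, c i = 0) (hcl : c l ≠ 0) :
    MemS K (fun j => if j = l then α j + 1 else α j) ((residueKer B c).map R.subtype) := by
  apply memS_of_pivots
  · intro i
    rcases lt_trichotomy i l with hi | rfl | hi
    · refine ⟨B i, ⟨B i, ?_, rfl⟩, hB i, by simp [hBi, hi.ne]⟩
      rw [SetLike.mem_coe, mem_residueKer, residueForm_basis, hc i hi]
    · refine ⟨X • B i, ⟨(X : PowerSeries K) • B i, ?_, rfl⟩, Submodule.smul_mem _ _ (hB i), ?_⟩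
      · rw [SetLike.mem_coe, mem_residueKer, residueForm_smul]
        simp
      · simp [hBi, pow_succ']
    · refine ⟨_, ⟨B i - C (c i / c l) • B l, ?_, rfl⟩, ?_, ?_⟩
      · rw [SetLike.mem_coe, mem_residueKer, map_sub, residueForm_smul, residueForm_basis,
          residueForm_basis, constantCoeff_C, div_mul_cancel₀ _ hcl, sub_self]
      · intro j hj
        simp [hB i j hj, hB l j (hi.trans hj)]
      · simp [hBi, hB l i hi, hi.ne']
  · rintro i _ ⟨v, hv, rfl⟩ hvi
    by_cases hil : i = l
    · subst hil
      obtain ⟨h0, hi⟩ := hrepr i v hvi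
      rw [SetLike.mem_coe, mem_residueKer, residueForm_apply, Finset.sum_eq_single i _ (by simp)]
        at hv
      · have hX : X ∣ B.repr v i := by
          rw [X_dvd_iff]
          exact (mul_eq_zero.1 hv).resolve_left hcl
        simpa [hi, pow_succ'] using mul_dvd_mul_right hX (X ^ α i)
      · intro j _ hji
        rcases lt_or_gt_of_ne hji with hj | hj
        · simp [hc j hj]
        · simp [h0 j hj]
    · simpa [hil] using h.pow_dvd v.2 hvi

theorem ne_zero_of_memS_residueKer
    (hB : ∀ i, (B i : Fin n → PowerSeries K) ∈ coordsLE K i)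
    (hBi : ∀ i, (B i : Fin n → PowerSeries K) i = X ^ α i)
    (hrepr : ∀ (i : Fin n) (v : R), (v : Fin n → PowerSeries K) ∈ coordsLE K i →
        (∀ j, i < j → B.repr v j = 0) ∧
          (v : Fin n → PowerSeries K) i = B.repr v i * X ^ α i)
    {l : Fin n} {c : Fin n → K}
    (hS : MemS K (fun j => if j = l then α j + 1 else α j) ((residueKer B c).map R.subtype)) :
    (∀ i < l, c i = 0) ∧ c l ≠ 0 := by
  constructor
  · intro i
    induction i using WellFoundedLT.induction with
    | ind i ih =>
      intro hil
      obtain ⟨_, ⟨v, hv, rfl⟩, hvi, hpiv⟩ := hS.exists_pivot i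
      obtain ⟨h0, hi⟩ := hrepr i v hvi
      have hone : B.repr v i = 1 := by
        apply mul_right_cancel₀ (pow_ne_zero (α i) (X_ne_zero (R := K)))
        rw [← hi, one_mul]
        simpa [hil.ne] using hpiv
      rw [SetLike.mem_coe, mem_residueKer, residueForm_apply, Finset.sum_eq_single i _ (by simp)]
        at hv
      · simpa [hone] using hv
      · intro j _ hji
        rcases lt_or_gt_of_ne hji with hj | hj
        · simp [ih j hj (hj.trans hil)]
        · simp [h0 j hj]
  · intro hcl
    have hmem : (B l : Fin n → PowerSeries K) ∈ (residueKer B c).map R.subtype :=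
      ⟨B l, by rw [SetLike.mem_coe, mem_residueKer, residueForm_basis, hcl], rfl⟩
    have hdvd := hS.pow_dvd hmem (hB l)
    rw [hBi, if_pos rfl, pow_dvd_pow_iff X_ne_zero X_prime.not_isUnit] at hdvd
    omega

end TriangularBasis

/-- The vector with entries `0` before `l`, `1` at `l` and `p` after `l`. -/
def normalizedVector {K : Type*} [Field K] {n : ℕ} (l : Fin n) (p : {j : Fin n // l < j} → K) :
    Fin n → K :=
  fun j => if h : l < j then p ⟨j, h⟩ else if j = l then 1 else 0

/-- For a lattice `R' ∈ S_{α'}` and `β` obtained from `α'` by increasing the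
`l`-th entry by one, the set of sublattices `R ⊆ R'` with `dim_K(R'/R) = 1` and `R ∈ S_β` is in
bijection with the affine space `K^{n−l}`. -/
theorem stmt16 {n : ℕ} (α' : Fin n → ℕ)
    (R' : Submodule (PowerSeries K) (Fin n → PowerSeries K))
    (hR' : IsLattice K R') (hS' : MemS K α' R') (l : Fin n) :
    Nonempty
      ({R : Submodule (PowerSeries K) (Fin n → PowerSeries K) //
          R ≤ R' ∧
          Module.finrank K
            (R' ⧸ Submodule.restrictScalars K (R.comap R'.subtype)) = 1 ∧
          MemS K (fun j => if j = l then α' j + 1 else α' j) R} ≃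
        (Fin (n - 1 - (l : ℕ)) → K)) := by
  obtain ⟨B, hB, hBi, hrepr⟩ := hS'.exists_basis
  have hcard : Fintype.card {j : Fin n // l < j} = Fintype.card (Fin (n - 1 - (l : ℕ))) := by
    rw [Fintype.card_fin, Fintype.card_subtype, Finset.filter_lt_eq_Ioi, Fin.card_Ioi]
  have hbefore (p : {j : Fin n // l < j} → K) : ∀ i < l, normalizedVector l p i = 0 :=
    fun i hi => by simp [normalizedVector, hi.not_gt, hi.ne]
  have hat (p : {j : Fin n // l < j} → K) : normalizedVector l p l = 1 := by
    simp [normalizedVector]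
  have hcomap (c : Fin n → K) : ((residueKer B c).map R'.subtype).comap R'.subtype =
      residueKer B c := Submodule.comap_map_eq_of_injective R'.subtype_injective _
  let F (p : {j : Fin n // l < j} → K) : {R : Submodule (PowerSeries K) (Fin n → PowerSeries K) //
      R ≤ R' ∧
      Module.finrank K (R' ⧸ Submodule.restrictScalars K (R.comap R'.subtype)) = 1 ∧
      MemS K (fun j => if j = l then α' j + 1 else α' j) R} :=
    ⟨(residueKer B (normalizedVector l p)).map R'.subtype, Submodule.map_subtype_le _ _, by
      rw [hcomap]
      exact finrank_quotient_residueKer B _ (i := l) (by simp [hat]),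
      hS'.memS_residueKer hB hBi hrepr (hbefore p) (by simp [hat])⟩
  have hinj : Function.Injective F := by
    intro p q hpq
    have heq : residueKer B (normalizedVector l p) = residueKer B (normalizedVector l q) :=
      Submodule.map_injective_of_injective R'.subtype_injective (congrArg Subtype.val hpq)
    funext ⟨j, hj⟩
    have hform (r : {j : Fin n // l < j} → K) :
        residueForm B (normalizedVector l r) (B j - C (p ⟨j, hj⟩) • B l) =
          r ⟨j, hj⟩ - p ⟨j, hj⟩ := by
      rw [map_sub, residueForm_smul, residueForm_basis, residueForm_basis, hat]
      simp [normalizedVector, hj]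
    have hmem : B j - C (p ⟨j, hj⟩) • B l ∈ residueKer B (normalizedVector l p) := by
      rw [mem_residueKer, hform, sub_self]
    rw [heq, mem_residueKer, hform, sub_eq_zero] at hmem
    exact hmem.symm
  have hsurj : Function.Surjective F := by
    rintro ⟨R, hle, hrank, hS⟩
    obtain ⟨c, hc⟩ := exists_eq_residueKer B _ hrank
    obtain rfl : R = (residueKer B c).map R'.subtype := by
      rw [← hc, Submodule.map_comap_subtype, inf_eq_right.2 hle]
    obtain ⟨hc0, hcl⟩ := ne_zero_of_memS_residueKer hB hBi hrepr hS
    refine ⟨fun j => (c l)⁻¹ * c j, Subtype.ext ?_⟩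
    have hnorm : normalizedVector l (fun j => (c l)⁻¹ * c j) = (c l)⁻¹ • c := by
      funext j
      rcases lt_trichotomy j l with hj | rfl | hj
      · simp [hbefore _ j hj, hc0 j hj]
      · simp [hat, hcl]
      · simp [normalizedVector, hj]
    simp only [F, hnorm, residueKer_smul B c (inv_ne_zero hcl)]
  exact ⟨(Equiv.ofBijective F ⟨hinj, hsurj⟩).symm.trans
    (Equiv.arrowCongr (Fintype.equivOfCardEq hcard) (Equiv.refl K))⟩

end
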